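/- arXiv:1505.00888 — 3 statements merged into one kernel-verified Lean document; each statement's English description precedes it below -/
import Mathlib

section
/- If G is a finite (2,*)-group, then either the soluble radical of G is trivial, or there exists a minimal normal subgroup N of G that is elementary abelian (i.e., N is a nontrivial elementary abelian p-group for some prime p) such that the quotient G/N is either a (2,*)-group (of order strictly smaller than |G|) or a cyclic group of odd order. -/
/-- A group is a `(2,*)`-group if it can be generated by two (not necessarily distinct)
elements, one of which is an involution. -/
def IsTwoStarGroup (G : Type u) [Group G] : Prop :=
  ∃ x g : G, x ^ 2 = 1 ∧ x ≠ 1 ∧ Subgroup.closure {x, g} = ⊤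

/-- A normal subgroup that is minimal among the nontrivial normal subgroups and soluble is
elementary abelian. -/
theorem Subgroup.elementaryAbelian_of_minimal_normal {G : Type*} [Group G] [Finite G]
    (N : Subgroup G) [N.Normal] [Group.IsSolvable N] (hN : N ≠ ⊥)
    (hmin : ∀ K : Subgroup G, K.Normal → K ≤ N → K = ⊥ ∨ K = N) :
    ∃ p : ℕ, p.Prime ∧ (∀ a b : N, a * b = b * a) ∧ ∀ a : N, a ≠ 1 → orderOf a = p := by
  have : Nontrivial N := N.nontrivial_iff_ne_bot.mpr hN
  have hcomm : ⁅N, N⁆ = ⊥ := by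
    refine (hmin ⁅N, N⁆ inferInstance (Subgroup.commutator_le_left N N)).resolve_right ?_
    have hlt : ⁅N.subtype.range, N.subtype.range⁆ < N.subtype.range := by
      rw [MonoidHom.range_eq_map, ← Subgroup.map_commutator,
        Subgroup.map_subtype_lt_map_subtype]
      exact Group.IsSolvable.commutator_lt_top_of_nontrivial N
    rw [N.range_subtype] at hlt
    exact hlt.ne
  have hab : ∀ a ∈ N, ∀ b ∈ N, a * b = b * a := by
    intro a ha b hb
    rw [Subgroup.commutator_eq_bot_iff_le_centralizer] at hcomm
    exact (Subgroup.mem_centralizer_iff.mp (hcomm ha) b hb).symm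
  obtain ⟨p, hp, hpd⟩ := Nat.exists_prime_and_dvd (Finite.one_lt_card (α := N)).ne'
  have : Fact p.Prime := ⟨hp⟩
  let T : Subgroup G :=
    { carrier := {a | a ∈ N ∧ a ^ p = 1}
      one_mem' := ⟨N.one_mem, one_pow p⟩
      mul_mem' := by
        rintro a b ⟨ha, hap⟩ ⟨hb, hbp⟩
        refine ⟨N.mul_mem ha hb, ?_⟩
        rw [Commute.mul_pow (hab a ha b hb), hap, hbp, one_mul]
      inv_mem' := by
        rintro a ⟨ha, hap⟩
        exact ⟨N.inv_mem ha, by rw [inv_pow, hap, inv_one]⟩ }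
  have hTnormal : T.Normal := by
    constructor
    rintro a ⟨ha, hap⟩ g
    exact ⟨Subgroup.Normal.conj_mem inferInstance a ha g, by rw [conj_pow, hap]; group⟩
  have hT : T = N := by
    refine (hmin T hTnormal fun a ha => ha.1).resolve_left fun hbot => ?_
    obtain ⟨a, ha⟩ := exists_prime_orderOf_dvd_card' (G := N) p hpd
    have haT : (a : G) ∈ T :=
      ⟨a.2, by rw [← Subgroup.coe_pow, ← ha, pow_orderOf_eq_one, Subgroup.coe_one]⟩
    rw [hbot, Subgroup.mem_bot, OneMemClass.coe_eq_one] at haT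
    rw [haT, orderOf_one] at ha
    exact hp.one_lt.ne ha
  refine ⟨p, hp, fun a b => Subtype.ext (hab a a.2 b b.2), fun a ha => ?_⟩
  have haT : (a : G) ∈ T := hT.ge a.2
  exact orderOf_eq_prime (Subtype.ext haT.2) ha

/-- A finite cyclic group is a `(2,*)`-group or has odd order. -/
theorem IsCyclic.isTwoStarGroup_or_odd_card (G : Type*) [Group G] [Finite G] [IsCyclic G] :
    IsTwoStarGroup G ∨ Odd (Nat.card G) := by
  rcases Nat.even_or_odd (Nat.card G) with heven | hodd
  · obtain ⟨g, hg⟩ := IsCyclic.exists_generator (α := G)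
    obtain ⟨z, hz⟩ := exists_prime_orderOf_dvd_card' (G := G) 2 heven.two_dvd
    obtain ⟨hz2, hz1⟩ := orderOf_eq_prime_iff.mp hz
    refine Or.inl ⟨z, g, hz2, hz1, eq_top_iff.mpr fun a _ => ?_⟩
    exact (Subgroup.zpowers_le.mpr (Subgroup.subset_closure (by simp))) (hg a)
  · exact Or.inr hodd

/-- A quotient of a finite `(2,*)`-group is a `(2,*)`-group or a cyclic group of odd order. -/
theorem IsTwoStarGroup.quotient {G : Type*} [Group G] [Finite G] (hG : IsTwoStarGroup G)
    (N : Subgroup G) [N.Normal] :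
    IsTwoStarGroup (G ⧸ N) ∨ IsCyclic (G ⧸ N) ∧ Odd (Nat.card (G ⧸ N)) := by
  obtain ⟨x, g, hx2, -, hgen⟩ := hG
  have hgen' : Subgroup.closure {(x : G ⧸ N), (g : G ⧸ N)} = ⊤ := by
    have h := congrArg (Subgroup.map (QuotientGroup.mk' N)) hgen
    rw [MonoidHom.map_closure, Set.image_pair,
      Subgroup.map_top_of_surjective _ (QuotientGroup.mk'_surjective N)] at h
    exact h
  by_cases hx : (x : G ⧸ N) = 1
  · have hcyc : IsCyclic (G ⧸ N) := by
      rw [hx, Subgroup.closure_insert_one, ← Subgroup.zpowers_eq_closure] at hgen'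
      exact isCyclic_iff_exists_zpowers_eq_top.mpr ⟨_, hgen'⟩
    exact (IsCyclic.isTwoStarGroup_or_odd_card (G ⧸ N)).imp_right fun h => ⟨hcyc, h⟩
  · exact Or.inl ⟨x, g, by rw [← QuotientGroup.mk_pow, hx2, QuotientGroup.mk_one], hx, hgen'⟩

/-- If `G` is a finite `(2,*)`-group, then either the soluble radical of `G` is trivial
(i.e. every normal soluble subgroup of `G` is trivial), or `G` has a minimal normal
subgroup `N` which is elementary abelian, such that `G/N` is either a `(2,*)`-group of
order strictly smaller than `|G|`, or a cyclic group of odd order. -/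
theorem two_star_group_extension_dichotomy (G : Type) [Group G] [Finite G]
    (hG : IsTwoStarGroup G) :
    (∀ K : Subgroup G, K.Normal → IsSolvable K → K = ⊥) ∨
    ∃ (N : Subgroup G) (hN : N.Normal),
      -- `N` is a minimal normal subgroup of `G`:
      N ≠ ⊥ ∧
      (∀ K : Subgroup G, K.Normal → K ≤ N → K = ⊥ ∨ K = N) ∧
      -- `N` is elementary abelian:
      (∃ p : ℕ, p.Prime ∧ (∀ a b : N, a * b = b * a) ∧ ∀ a : N, a ≠ 1 → orderOf a = p) ∧
      -- the quotient `G/N` is a smaller `(2,*)`-group or a cyclic group of odd order: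
      (letI := hN
       (IsTwoStarGroup (G ⧸ N) ∧ Nat.card (G ⧸ N) < Nat.card G) ∨
       (IsCyclic (G ⧸ N) ∧ Odd (Nat.card (G ⧸ N)))) := by
  by_cases hrad : ∀ K : Subgroup G, K.Normal → IsSolvable K → K = ⊥
  · exact Or.inl hrad
  push Not at hrad
  obtain ⟨K, hK, hKsol, hKne⟩ := hrad
  obtain ⟨N, hNK, ⟨hN, hNne⟩, hNmin⟩ :=
    exists_minimal_le_of_wellFoundedLT (fun H : Subgroup G => H.Normal ∧ H ≠ ⊥) K ⟨hK, hKne⟩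
  have hmin : ∀ H : Subgroup G, H.Normal → H ≤ N → H = ⊥ ∨ H = N := fun H hH hHN =>
    or_iff_not_imp_left.mpr fun hne => le_antisymm hHN (hNmin ⟨hH, hne⟩ hHN)
  have hKsol : Group.IsSolvable K := hKsol
  have hNsol : Group.IsSolvable N :=
    Group.isSolvable_of_isSolvable_injective (Subgroup.inclusion_injective hNK)
  refine Or.inr ⟨N, hN, hNne, hmin, N.elementaryAbelian_of_minimal_normal hNne hmin, ?_⟩
  have hcard : Nat.card (G ⧸ N) < Nat.card G := by
    rw [N.card_eq_card_quotient_mul_card_subgroup]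
    exact lt_mul_of_one_lt_right Nat.card_pos (N.one_lt_card_iff_ne_bot.mpr hNne)
  exact (hG.quotient N).imp_left fun h => ⟨h, hcard⟩
end

section
/- Let (G,R,S) be a reflexible oriented rotary map with reflector τ (an automorphism of G of order at most 2 with τ(R) = R⁻¹ and τ(S) = S⁻¹). Let A = G ⋊ C2 be the semidirect product where the generator b of C2 acts on G by τ, and set a = Rb and c = bS (identifying G and C2 with their images in A). Then a, b, c are involutions in A with a ≠ c, the subgroup ⟨a,c⟩ is a Klein four-group (has order 4), the set {a,b,c} generates A, and the subgroup ⟨ab,bc⟩ has index 2 in A; in particular (A,a,b,c) is an orientable regular map. -/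
/-- Two distinct commuting involutions generate a subgroup of order four. -/
theorem Subgroup.card_closure_pair_of_involutions {A : Type*} [Group A] {a c : A}
    (ha : a * a = 1) (hc : c * c = 1) (hac : a * c = c * a)
    (ha1 : a ≠ 1) (hc1 : c ≠ 1) (hne : a ≠ c) :
    Nat.card (Subgroup.closure {a, c}) = 4 := by
  classical
  have hac1 : a * c ≠ 1 := fun h => hne (mul_right_cancel (h.trans hc.symm))
  have key : ((Subgroup.closure {a, c} : Subgroup A) : Set A)
      = (({1, a, c, a * c} : Finset A) : Set A) := by
    ext x
    simp only [SetLike.mem_coe, Finset.coe_insert, Finset.coe_singleton,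
      Set.mem_insert_iff, Set.mem_singleton_iff]
    have hma : a ∈ Subgroup.closure {a, c} := Subgroup.subset_closure (by simp)
    have hmc : c ∈ Subgroup.closure {a, c} := Subgroup.subset_closure (by simp)
    constructor
    · intro hx
      induction hx using Subgroup.closure_induction_left with
      | one => exact Or.inl rfl
      | mul_left y hy z _ ih =>
        rcases hy with rfl | rfl <;> rcases ih with rfl | rfl | rfl | rfl <;>
          simp [ha, hc, ← mul_assoc, ← hac]
        all_goals simp [mul_assoc, hc]
      | inv_mul_cancel y hy z _ ih =>
        rcases hy with rfl | rfl
        · rw [inv_eq_of_mul_eq_one_left ha]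
          rcases ih with rfl | rfl | rfl | rfl <;> simp [ha, ← mul_assoc]
        · rw [inv_eq_of_mul_eq_one_left hc]
          rcases ih with rfl | rfl | rfl | rfl <;> simp [hc, hac, ← mul_assoc]
    · rintro (rfl | rfl | rfl | rfl)
      exacts [one_mem _, hma, hmc, mul_mem hma hmc]
  change Nat.card ((Subgroup.closure {a, c} : Subgroup A) : Set A) = 4
  rw [key, Nat.card_coe_set_eq, Set.ncard_coe_finset]
  have h1 : a ≠ a * c := fun h => hc1 (left_eq_mul.mp h)
  have h2 : c ≠ a * c := fun h => ha1 (right_eq_mul.mp h)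
  simp [Finset.card_insert_of_notMem, ha1.symm, hc1.symm, hac1.symm, hne, h1, h2]


/-- Let `(G, R, S)` be a reflexible oriented rotary map with reflector `τ`
(an automorphism of order at most two with `τ(R) = R⁻¹`, `τ(S) = S⁻¹`).
Let `A = G ⋊ C₂` be the semidirect product in which the generator `b` of
`C₂ = Multiplicative (ZMod 2)` acts on `G` by `τ` (i.e. `A = G ⋊[φ] C₂` for a
homomorphism `φ : C₂ →* Aut(G)` with `φ(b) = τ`), and set `a = R·b` and `c = b·S`
(identifying `G` and `C₂` with their images in `A`).  Then `a`, `b`, `c` are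
involutions in `A`, `a ≠ c`, the subgroup `⟨a, c⟩` is a Klein four-group (order `4`),
`{a, b, c}` generates `A`, and `⟨ab, bc⟩` has index `2` in `A`; thus `(A, a, b, c)`
is an orientable regular map. -/
theorem orientable_regularisation (G : Type) [Group G] (R S : G)
    (hgen : Subgroup.closure {R, S} = ⊤)
    (hinv : (R * S) ^ 2 = 1) (hne : R * S ≠ 1)
    (τ : MulAut G) (hR : τ R = R⁻¹) (hS : τ S = S⁻¹) (hτ : τ * τ = 1)
    (φ : Multiplicative (ZMod 2) →* MulAut G)
    (hφ : φ (Multiplicative.ofAdd (1 : ZMod 2)) = τ)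
    (b : G ⋊[φ] Multiplicative (ZMod 2))
    (hb : b = SemidirectProduct.inr (Multiplicative.ofAdd (1 : ZMod 2)))
    (a c : G ⋊[φ] Multiplicative (ZMod 2))
    (ha : a = SemidirectProduct.inl R * b)
    (hc : c = b * SemidirectProduct.inl S) :
    (a ^ 2 = 1 ∧ a ≠ 1) ∧ (b ^ 2 = 1 ∧ b ≠ 1) ∧ (c ^ 2 = 1 ∧ c ≠ 1) ∧
    a ≠ c ∧
    Nat.card (Subgroup.closure {a, c} :
      Subgroup (G ⋊[φ] Multiplicative (ZMod 2))) = 4 ∧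
    Subgroup.closure {a, b, c} = (⊤ : Subgroup (G ⋊[φ] Multiplicative (ZMod 2))) ∧
    (Subgroup.closure {a * b, b * c} :
      Subgroup (G ⋊[φ] Multiplicative (ZMod 2))).index = 2 := by
  set g : Multiplicative (ZMod 2) := Multiplicative.ofAdd 1 with hg
  have hgg : g * g = 1 := by decide
  have hg1 : g ≠ 1 := by decide
  have hbb : b * b = 1 := by rw [hb, ← map_mul, hgg, map_one]
  have hconj (x : G) : b * SemidirectProduct.inl x * b = SemidirectProduct.inl (τ x) := by
    have hbi : b⁻¹ = b := inv_eq_of_mul_eq_one_left hbb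
    rw [← hφ, SemidirectProduct.inl_aut, map_inv, ← hb, hbi]
  have haa : a * a = 1 := by
    rw [ha, mul_assoc, ← mul_assoc b, hconj, hR, ← map_mul, mul_inv_cancel, map_one]
  have hcc : c * c = 1 := by
    rw [hc, ← mul_assoc, hconj, hS, ← map_mul, inv_mul_cancel, map_one]
  have hrb : SemidirectProduct.rightHom b = g := by rw [hb, SemidirectProduct.rightHom_inr]
  have hra : SemidirectProduct.rightHom a = g := by
    rw [ha, map_mul, SemidirectProduct.rightHom_inl, hrb, one_mul]
  have hrc : SemidirectProduct.rightHom c = g := by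
    rw [hc, map_mul, SemidirectProduct.rightHom_inl, hrb, mul_one]
  have ne_one {x : G ⋊[φ] Multiplicative (ZMod 2)} (hx : SemidirectProduct.rightHom x = g) :
      x ≠ 1 := by
    rintro rfl
    exact hg1 (by rw [← hx, map_one])
  have hab : a * b = SemidirectProduct.inl R := by rw [ha, mul_assoc, hbb, mul_one]
  have hbc : b * c = SemidirectProduct.inl S := by rw [hc, ← mul_assoc, hbb, one_mul]
  have hac : a * c = SemidirectProduct.inl (R * S) := by rw [ha, mul_assoc, hbc, map_mul]
  have hacac : (a * c) * (a * c) = 1 := by rw [hac, ← map_mul, ← pow_two, hinv, map_one]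
  have hcomm : a * c = c * a := by
    rw [eq_comm, ← inv_eq_of_mul_eq_one_left hacac, mul_inv_rev,
      inv_eq_of_mul_eq_one_left haa, inv_eq_of_mul_eq_one_left hcc]
  have hne_ac : a ≠ c := by
    rintro rfl
    exact hne (SemidirectProduct.inl_injective (by rw [← hac, haa, map_one]))
  have hcl : (Subgroup.closure {a * b, b * c} : Subgroup (G ⋊[φ] Multiplicative (ZMod 2)))
      = (SemidirectProduct.inl : G →* G ⋊[φ] Multiplicative (ZMod 2)).range := by
    rw [MonoidHom.range_eq_map, ← hgen, MonoidHom.map_closure, Set.image_pair, hab, hbc]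
  refine ⟨⟨by rw [pow_two, haa], ne_one hra⟩, ⟨by rw [pow_two, hbb], ne_one hrb⟩,
    ⟨by rw [pow_two, hcc], ne_one hrc⟩, hne_ac,
    Subgroup.card_closure_pair_of_involutions haa hcc hcomm (ne_one hra) (ne_one hrc) hne_ac,
    ?_, ?_⟩
  · have hma : a ∈ Subgroup.closure {a, b, c} := Subgroup.subset_closure (by simp)
    have hmb : b ∈ Subgroup.closure {a, b, c} := Subgroup.subset_closure (by simp)
    have hmc : c ∈ Subgroup.closure {a, b, c} := Subgroup.subset_closure (by simp)
    have hle : (SemidirectProduct.inl : G →* G ⋊[φ] Multiplicative (ZMod 2)).range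
        ≤ Subgroup.closure {a, b, c} := by
      rw [← hcl, Subgroup.closure_le, Set.pair_subset_iff]
      exact ⟨mul_mem hma hmb, mul_mem hmb hmc⟩
    rw [eq_top_iff]
    intro x _
    rw [← SemidirectProduct.inl_left_mul_inr_right x]
    refine mul_mem (hle ⟨_, rfl⟩) ?_
    have hC : ∀ y : Multiplicative (ZMod 2), y = 1 ∨ y = g := by decide
    rcases hC x.right with h | h
    · rw [h, map_one]
      exact one_mem _
    · rw [h, ← hb]
      exact hmb
  · rw [hcl, SemidirectProduct.range_inl_eq_ker_rightHom, Subgroup.index_ker,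
      MonoidHom.range_eq_top.mpr SemidirectProduct.rightHom_surjective, Subgroup.card_top,
      Nat.card_eq_fintype_card]
    rfl
end

section
/- Let (G,R,S) be an oriented rotary map and let b1 and b2 be antipodal reflectors of (G,R,S). If there exists an automorphism φ of G with φ(Rb1) = Rb2, φ(b1) = b2 and φ(b1 S) = b2 S (i.e., the non-orientable regularisations (G, Rb1, b1, b1S) and (G, Rb2, b2, b2S) are isomorphic as regular maps), then φ is the identity automorphism and b1 = b2. -/
/-- `b` is an antipodal reflector of the oriented rotary map `(G, R, S)`: an
involution of `G` conjugating `R` to `R⁻¹` and `S` to `S⁻¹`. -/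
def IsAntipodalReflector (G : Type) [Group G] (R S b : G) : Prop :=
  b ^ 2 = 1 ∧ b ≠ 1 ∧ b * R * b = R⁻¹ ∧ b * S * b = S⁻¹

/-- Let `(G, R, S)` be an oriented rotary map and let `b₁`, `b₂` be antipodal
reflectors of `(G, R, S)`.  If an automorphism `φ` of `G` maps `(R·b₁, b₁, b₁·S)` to
`(R·b₂, b₂, b₂·S)` (i.e. the corresponding non-orientable regularisations are
isomorphic as regular maps), then `φ` is the identity and `b₁ = b₂`. -/
theorem non_orientable_regularisations_distinct (G : Type) [Group G] (R S : G)
    (hgen : Subgroup.closure {R, S} = ⊤)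
    (hinv : (R * S) ^ 2 = 1) (hne : R * S ≠ 1)
    (b₁ b₂ : G)
    (hb₁ : IsAntipodalReflector G R S b₁) (hb₂ : IsAntipodalReflector G R S b₂)
    (φ : G ≃* G)
    (ha : φ (R * b₁) = R * b₂) (hb : φ b₁ = b₂) (hc : φ (b₁ * S) = b₂ * S) :
    (∀ g : G, φ g = g) ∧ b₁ = b₂ := by
  have hR : φ R = R := by
    rw [map_mul, hb] at ha
    exact mul_right_cancel ha
  have hS : φ S = S := by
    rw [map_mul, hb] at hc
    exact mul_left_cancel hc
  have hφ : φ.toMonoidHom = MonoidHom.id G := by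
    refine MonoidHom.eq_of_eqOn_dense hgen ?_
    rintro x (rfl | rfl)
    · exact hR
    · exact hS
  have hid (g : G) : φ g = g := DFunLike.congr_fun hφ g
  exact ⟨hid, (hid b₁).symm.trans hb⟩
end
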